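/- arXiv:1611.08519 — 8 statements merged into one kernel-verified Lean document; each statement's English description precedes it below -/
import Mathlib

section
/- Fundamental theorem of matrix product states: Let d, D ≥ 1 and let A^i, B^i ∈ M_D(ℂ) for i ∈ {0,…,d−1} be two families of matrices, each injective in the sense that the complex linear span of all finite products A^{i₁}A^{i₂}⋯A^{i_k} (k ≥ 1) equals all of M_D(ℂ), and likewise for the B^i. If for every N ≥ 1 and every index string (i₁,…,i_N) ∈ {0,…,d−1}^N one has Tr(A^{i₁}A^{i₂}⋯A^{i_N}) = Tr(B^{i₁}B^{i₂}⋯B^{i_N}), then there exists an invertible matrix X ∈ M_D(ℂ) such that A^i X = X B^i for all i. -/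
/-- A family of `D × D` complex matrices is *injective* if the complex linear span of all
finite (nonempty) products of members of the family is all of `M_D(ℂ)`. -/
def MPSInjective {d D : ℕ} (A : Fin d → Matrix (Fin D) (Fin D) ℂ) : Prop :=
  Submodule.span ℂ
      {M : Matrix (Fin D) (Fin D) ℂ | ∃ l : List (Fin d), l ≠ [] ∧ (l.map A).prod = M} = ⊤

/-- Two surjective algebra homomorphisms with the same kernel differ by an algebra
isomorphism of their codomains. -/
theorem AlgHom.exists_algEquiv_of_eq_iff_eq {R F S T : Type*} [CommSemiring R] [Semiring F]
    [Semiring S] [Semiring T] [Algebra R F] [Algebra R S] [Algebra R T]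
    (f : F →ₐ[R] S) (g : F →ₐ[R] T) (hf : Function.Surjective f) (hg : Function.Surjective g)
    (h : ∀ x y, f x = f y ↔ g x = g y) : ∃ e : S ≃ₐ[R] T, ∀ x, e (f x) = g x := by
  choose s hs using hf
  have key : ∀ x, g (s (f x)) = g x := fun x => (h _ _).1 (hs _)
  let e : S →ₐ[R] T :=
    { toFun := fun m => g (s m)
      map_one' := by simpa using key 1
      map_zero' := by simpa using key 0
      map_mul' := fun m n => by rw [← map_mul]; exact (h _ _).1 (by simp [hs])
      map_add' := fun m n => by rw [← map_add]; exact (h _ _).1 (by simp [hs])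
      commutes' := fun r => by simpa using key (algebraMap R F r) }
  have he : ∀ x, e (f x) = g x := key
  refine ⟨AlgEquiv.ofBijective e ⟨fun m n hmn => ?_, fun t => ?_⟩, he⟩
  · have := (h (s m) (s n)).2 hmn
    rwa [hs, hs] at this
  · obtain ⟨x, rfl⟩ := hg t
    exact ⟨f x, he x⟩

/-- Every algebra automorphism of a matrix algebra over a field is inner. -/
theorem Matrix.exists_isUnit_forall_mul_eq_mul {K n : Type*} [Field K] [Fintype n]
    [DecidableEq n] (e : Matrix n n K ≃ₐ[K] Matrix n n K) :
    ∃ X : Matrix n n K, IsUnit X ∧ ∀ M, e M * X = X * M := by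
  let τ : Matrix n n K ≃ₐ[K] Module.End K (n → K) := Matrix.toLinAlgEquiv'
  obtain ⟨T, hT⟩ := ((τ.symm.trans e).trans τ).eq_linearEquivConjAlgEquiv
  have hu : IsUnit (T : Module.End K (n → K)) :=
    (Module.End.isUnit_iff _).2 T.bijective
  refine ⟨τ.symm (T : Module.End K (n → K)), hu.map τ.symm, fun M => τ.injective ?_⟩
  have hM := DFunLike.congr_fun hT (τ M)
  simp only [AlgEquiv.trans_apply, AlgEquiv.symm_apply_apply] at hM
  rw [map_mul, map_mul, AlgEquiv.apply_symm_apply, hM]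
  refine LinearMap.ext fun v => ?_
  simp [LinearEquiv.conjAlgEquiv_apply]

/-- The evaluation of noncommutative polynomials at a family of matrices. -/
noncomputable def MPSEval {d D : ℕ} (A : Fin d → Matrix (Fin D) (Fin D) ℂ) :
    MonoidAlgebra ℂ (FreeMonoid (Fin d)) →ₐ[ℂ] Matrix (Fin D) (Fin D) ℂ :=
  MonoidAlgebra.lift ℂ _ (FreeMonoid (Fin d)) (FreeMonoid.lift A)

theorem MPSEval_of {d D : ℕ} (A : Fin d → Matrix (Fin D) (Fin D) ℂ) (l : FreeMonoid (Fin d)) :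
    MPSEval A (MonoidAlgebra.of ℂ _ l) = (l.toList.map A).prod := by
  rw [MPSEval, MonoidAlgebra.lift_of, FreeMonoid.lift_apply]

theorem MPSInjective.surjective_MPSEval {d D : ℕ} {A : Fin d → Matrix (Fin D) (Fin D) ℂ}
    (hA : MPSInjective A) : Function.Surjective (MPSEval A) := by
  have : LinearMap.range (MPSEval A).toLinearMap = ⊤ := by
    rw [eq_top_iff, ← hA, Submodule.span_le]
    rintro _ ⟨l, -, rfl⟩
    exact ⟨MonoidAlgebra.of ℂ _ (FreeMonoid.ofList l), MPSEval_of A _⟩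
  exact LinearMap.range_eq_top.1 this

theorem trace_MPSEval_eq {d D : ℕ} {A B : Fin d → Matrix (Fin D) (Fin D) ℂ}
    (h : ∀ N : ℕ, 1 ≤ N → ∀ I : Fin N → Fin d,
      Matrix.trace (List.ofFn fun n => A (I n)).prod =
      Matrix.trace (List.ofFn fun n => B (I n)).prod)
    (x : MonoidAlgebra ℂ (FreeMonoid (Fin d))) :
    (MPSEval A x).trace = (MPSEval B x).trace := by
  induction x using MonoidAlgebra.induction_on with
  | of l =>
    rw [MPSEval_of, MPSEval_of]
    generalize l.toList = l
    rcases l with _ | ⟨i, l⟩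
    · simp
    · have hofFn : ∀ C : Fin d → Matrix (Fin D) (Fin D) ℂ,
          (List.ofFn fun n => C ((i :: l).get n)) = (i :: l).map C := fun C => by
        rw [← Function.comp_def, ← List.map_ofFn, List.ofFn_get]
      simpa only [hofFn] using h (i :: l).length (by simp) (i :: l).get
  | add x y hx hy => simp only [map_add, Matrix.trace_add, hx, hy]
  | smul r x hx => simp only [map_smul, Matrix.trace_smul, hx]

/-- If one family is injective, equality of traces shows that every relation satisfied by the
other family is satisfied by this one. -/
theorem MPSEval_eq_of_trace_eq {d D : ℕ} {A B : Fin d → Matrix (Fin D) (Fin D) ℂ}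
    (hA : MPSInjective A) (h : ∀ x, (MPSEval A x).trace = (MPSEval B x).trace)
    {x y : MonoidAlgebra ℂ (FreeMonoid (Fin d))} (hxy : MPSEval B x = MPSEval B y) :
    MPSEval A x = MPSEval A y := by
  refine Matrix.ext_iff_trace_mul_right.2 fun M => ?_
  obtain ⟨z, rfl⟩ := hA.surjective_MPSEval M
  rw [← map_mul, ← map_mul, h, h, map_mul, map_mul, hxy]

/-- **Fundamental theorem of matrix product states.**
If two injective families of matrices define the same translation-invariant matrix product
state coefficients `Tr(A^{i₁}⋯A^{i_N})` for all system sizes `N ≥ 1`, then they are related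
by an invertible gauge transformation `X` with `A^i X = X B^i` for all `i`. -/
theorem fundamental_theorem_of_MPS
    (d D : ℕ) (hd : 1 ≤ d) (hD : 1 ≤ D)
    (A B : Fin d → Matrix (Fin D) (Fin D) ℂ)
    (hA : MPSInjective A) (hB : MPSInjective B)
    (h : ∀ N : ℕ, 1 ≤ N → ∀ I : Fin N → Fin d,
      Matrix.trace (List.ofFn fun n => A (I n)).prod =
      Matrix.trace (List.ofFn fun n => B (I n)).prod) :
    ∃ X : Matrix (Fin D) (Fin D) ℂ, IsUnit X ∧ ∀ i, A i * X = X * B i := by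
  have ht := trace_MPSEval_eq h
  obtain ⟨e, he⟩ := (MPSEval B).exists_algEquiv_of_eq_iff_eq (MPSEval A)
    hB.surjective_MPSEval hA.surjective_MPSEval fun x y =>
      ⟨MPSEval_eq_of_trace_eq hA ht, MPSEval_eq_of_trace_eq hB fun z => (ht z).symm⟩
  obtain ⟨X, hX, hconj⟩ := Matrix.exists_isUnit_forall_mul_eq_mul e
  refine ⟨X, hX, fun i => ?_⟩
  have hi := he (MonoidAlgebra.of ℂ _ (FreeMonoid.of i))
  simp only [MPSEval_of, FreeMonoid.toList_of, List.map_singleton, List.prod_singleton] at hi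
  rw [← hi, hconj]
end

section
/- Existence of the R-matrix for commuting injective matrix product operators: Let A^{ij}, B^{ij} ∈ M_D(ℂ) for i,j ∈ {0,…,d−1}. Define C^{ij} = Σ_{k=0}^{d−1} A^{ik} ⊗ B^{kj} ∈ M_{D²}(ℂ) and C̃^{ij} = Σ_{k=0}^{d−1} B^{ik} ⊗ A^{kj} ∈ M_{D²}(ℂ). Assume both families {C^{ij}} and {C̃^{ij}} are injective (their finite products span all of M_{D²}(ℂ)), and assume that for every N ≥ 1 the matrix product operators commute: Ô_N(A)·Ô_N(B) = Ô_N(B)·Ô_N(A) as operators on (ℂ^d)^{⊗N}. Then there exists an invertible matrix R ∈ M_{D²}(ℂ) such that C^{ij} R = R C̃^{ij} for all i,j. -/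
/-- The translation-invariant matrix product operator with trace closure on `(ℂ^d)^{⊗N}`,
built from the 4-leg tensor `A : Fin d → Fin d → M_D(ℂ)`:
`Ô_N(A)_{(i₁…i_N),(j₁…j_N)} = Tr(A^{i₁j₁} ⋯ A^{i_Nj_N})`. -/
noncomputable def mpoTr {d D : ℕ} (A : Fin d → Fin d → Matrix (Fin D) (Fin D) ℂ) (N : ℕ) :
    Matrix (Fin N → Fin d) (Fin N → Fin d) ℂ :=
  fun I J => Matrix.trace (List.ofFn fun n => A (I n) (J n)).prod

/-- A family of matrices (indexed by pairs of physical indices) is *injective* if the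
complex linear span of all finite nonempty products of its members is the whole matrix
algebra. -/
def MPOInjective {d : ℕ} {V : Type*} [Fintype V] [DecidableEq V]
    (C : Fin d → Fin d → Matrix V V ℂ) : Prop :=
  Submodule.span ℂ
      {M : Matrix V V ℂ | ∃ l : List (Fin d × Fin d), l ≠ [] ∧
        (l.map fun p => C p.1 p.2).prod = M} = ⊤

open scoped Kronecker in
theorem Matrix.prod_ofFn_kronecker {R m n : Type*} [CommSemiring R] [Fintype m] [DecidableEq m]
    [Fintype n] [DecidableEq n] {N : ℕ} (F : Fin N → Matrix m m R) (G : Fin N → Matrix n n R) :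
    (List.ofFn fun i => F i ⊗ₖ G i).prod = (List.ofFn F).prod ⊗ₖ (List.ofFn G).prod := by
  induction N with
  | zero => simp
  | succ N ih =>
    simp only [List.ofFn_succ, List.prod_cons, Matrix.mul_kronecker_mul]
    rw [ih]

/-- Distributivity of an ordered product over sums in a noncommutative semiring. -/
theorem List.prod_ofFn_sum {R ι : Type*} [Semiring R] [Fintype ι] {N : ℕ}
    (F : Fin N → ι → R) :
    (List.ofFn fun n => ∑ k, F n k).prod =
      ∑ K : Fin N → ι, (List.ofFn fun n => F n (K n)).prod := by
  induction N with
  | zero => simp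
  | succ N ih =>
    rw [← (Fin.consEquiv fun _ => ι).sum_comp, Fintype.sum_prod_type]
    simp only [List.ofFn_succ, List.prod_cons, ih, Fin.consEquiv_apply, Fin.cons_zero,
      Fin.cons_succ, Finset.sum_mul_sum]

open scoped Kronecker in
/-- The entries of a product of two matrix product operators are traces of products of the
tensors of the product operator. -/
theorem mpoTr_mul_apply {d D : ℕ} (A B : Fin d → Fin d → Matrix (Fin D) (Fin D) ℂ) (N : ℕ)
    (I J : Fin N → Fin d) :
    (mpoTr A N * mpoTr B N) I J =
      (List.ofFn fun n => ∑ k, A (I n) k ⊗ₖ B k (J n)).prod.trace := by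
  simp only [List.prod_ofFn_sum, Matrix.trace_sum, Matrix.prod_ofFn_kronecker,
    Matrix.trace_kronecker, Matrix.mul_apply, mpoTr]

/-- Two algebra maps onto a full matrix algebra with the same trace have the same kernel. -/
theorem Matrix.eq_zero_of_trace_eq {K A n m : Type*} [CommRing K] [Ring A] [Algebra K A]
    [Fintype n] [Fintype m] [DecidableEq n] [DecidableEq m]
    {f : A →ₐ[K] Matrix n n K} {g : A →ₐ[K] Matrix m m K} (hg : Function.Surjective g)
    (h : ∀ x, (f x).trace = (g x).trace) {x : A} (hx : f x = 0) : g x = 0 := by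
  refine Matrix.ext_iff_trace_mul_right.mpr fun y => ?_
  obtain ⟨y, rfl⟩ := hg y
  rw [← map_mul, ← h, map_mul, hx]
  simp

/-- Two algebra maps onto a full matrix algebra with the same trace are conjugate. -/
theorem Matrix.exists_conj_of_trace_eq {K A n : Type*} [Field K] [Ring A] [Algebra K A]
    [Fintype n] [DecidableEq n] {f g : A →ₐ[K] Matrix n n K}
    (hf : Function.Surjective f) (hg : Function.Surjective g)
    (h : ∀ x, (f x).trace = (g x).trace) :
    ∃ R : Matrix n n K, IsUnit R ∧ ∀ x, f x * R = R * g x := by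
  have hker : RingHom.ker f = RingHom.ker g := by
    ext x
    exact ⟨Matrix.eq_zero_of_trace_eq hg h, Matrix.eq_zero_of_trace_eq hf fun y => (h y).symm⟩
  let φ : Matrix n n K ≃ₐ[K] Matrix n n K :=
    (Ideal.quotientKerAlgEquivOfSurjective hf).symm.trans
      ((Ideal.quotientEquivAlgOfEq K hker).trans (Ideal.quotientKerAlgEquivOfSurjective hg))
  have hφ (x : A) : φ (f x) = g x := by
    simp only [φ, AlgEquiv.trans_apply, Ideal.quotientKerAlgEquivOfSurjective_symm_apply,
      Ideal.quotientEquivAlgOfEq_mk, Ideal.quotientKerAlgEquivOfSurjective_mk]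
  obtain ⟨T, hT⟩ :=
    ((Matrix.toLinAlgEquiv'.symm.trans φ).trans
      Matrix.toLinAlgEquiv').eq_linearEquivConjAlgEquiv
  have key (x : A) : Matrix.toLinAlgEquiv' (g x) =
      T.toLinearMap ∘ₗ Matrix.toLinAlgEquiv' (f x) ∘ₗ T.symm.toLinearMap := by
    have := congr($hT (Matrix.toLinAlgEquiv' (f x)))
    simpa [hφ, LinearEquiv.conjAlgEquiv_apply] using this
  refine ⟨LinearMap.toMatrixAlgEquiv' T.symm.toLinearMap, ?_, fun x => ?_⟩
  · refine IsUnit.map _ (.of_mul_eq_one T.toLinearMap ?_)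
    refine LinearMap.ext fun v => ?_
    simp
  · apply Matrix.toLinAlgEquiv'.injective
    simp only [map_mul, Matrix.toLinAlgEquiv'_toMatrixAlgEquiv', key]
    refine LinearMap.ext fun v => ?_
    simp

/-- The algebra map from the free monoid algebra sending each generator to a matrix of an
injective family is onto. -/
theorem MPOInjective.lift_surjective {d : ℕ} {V : Type*} [Fintype V] [DecidableEq V]
    {C : Fin d → Fin d → Matrix V V ℂ} (hC : MPOInjective C) :
    Function.Surjective (MonoidAlgebra.lift ℂ (Matrix V V ℂ) (FreeMonoid (Fin d × Fin d))
      (FreeMonoid.lift fun p => C p.1 p.2)) := by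
  rw [← AlgHom.coe_toLinearMap, ← LinearMap.range_eq_top, eq_top_iff, ← hC, Submodule.span_le]
  rintro _ ⟨l, -, rfl⟩
  refine ⟨MonoidAlgebra.of ℂ _ (FreeMonoid.ofList l), ?_⟩
  simp [FreeMonoid.lift_apply]

/-- **Existence of the R-matrix for commuting injective matrix product operators.**
If the MPOs built from `A` and `B` commute for all sizes `N ≥ 1`, and the tensors
`C^{ij} = Σ_k A^{ik} ⊗ B^{kj}` and `C̃^{ij} = Σ_k B^{ik} ⊗ A^{kj}` of the two product MPOs
are injective, then there exists an invertible `R ∈ M_{D²}(ℂ)` with `C^{ij} R = R C̃^{ij}`. -/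
theorem exists_R_matrix
    (d D : ℕ)
    (A B : Fin d → Fin d → Matrix (Fin D) (Fin D) ℂ)
    (C Ct : Fin d → Fin d → Matrix (Fin D × Fin D) (Fin D × Fin D) ℂ)
    (hC : ∀ i j, C i j = ∑ k : Fin d,
      Matrix.of (fun p q : Fin D × Fin D => A i k p.1 q.1 * B k j p.2 q.2))
    (hCt : ∀ i j, Ct i j = ∑ k : Fin d,
      Matrix.of (fun p q : Fin D × Fin D => B i k p.1 q.1 * A k j p.2 q.2))
    (hinjC : MPOInjective C) (hinjCt : MPOInjective Ct)
    (hcomm : ∀ N : ℕ, 1 ≤ N → mpoTr A N * mpoTr B N = mpoTr B N * mpoTr A N) :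
    ∃ R : Matrix (Fin D × Fin D) (Fin D × Fin D) ℂ,
      IsUnit R ∧ ∀ i j, C i j * R = R * Ct i j := by
  let F (X : Fin d → Fin d → Matrix (Fin D × Fin D) (Fin D × Fin D) ℂ) :=
    MonoidAlgebra.lift ℂ (Matrix (Fin D × Fin D) (Fin D × Fin D) ℂ)
      (FreeMonoid (Fin d × Fin d)) (FreeMonoid.lift fun p => X p.1 p.2)
  have hword (l : List (Fin d × Fin d)) : (l.map fun p => C p.1 p.2).prod.trace =
      (l.map fun p => Ct p.1 p.2).prod.trace := by
    rcases eq_or_ne l [] with rfl | hl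
    · rfl
    have hlen := List.length_pos_iff.mpr hl
    have := congrFun₂ (hcomm l.length hlen) (fun n => (l.get n).1) fun n => (l.get n).2
    rw [mpoTr_mul_apply, mpoTr_mul_apply] at this
    rw [← List.ofFn_get l, List.map_ofFn, List.map_ofFn]
    simp only [Function.comp_def, hC, hCt]
    exact this
  have htrace (x) : (F C x).trace = (F Ct x).trace := by
    suffices Matrix.traceLinearMap _ ℂ ℂ ∘ₗ (F C).toLinearMap =
        Matrix.traceLinearMap _ ℂ ℂ ∘ₗ (F Ct).toLinearMap from congr($this x)
    refine MonoidAlgebra.lhom_ext' fun w => LinearMap.ext_ring ?_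
    simpa [F, FreeMonoid.lift_apply] using hword w.toList
  obtain ⟨R, hR, h⟩ :=
    Matrix.exists_conj_of_trace_eq hinjC.lift_surjective hinjCt.lift_surjective htrace
  refine ⟨R, hR, fun i j => ?_⟩
  simpa [F] using h (MonoidAlgebra.of ℂ _ (FreeMonoid.of (i, j)))
end

section
/- Algebraic Bethe ansatz expansion formulas: Let V be a complex vector space, let f(μ,λ) = 1 + i/(μ−λ) and g(μ,λ) = i/(μ−λ), and let μ, λ₁, …, λ_M ∈ ℂ be pairwise distinct. Suppose operators A(ν), B(ν), D(ν) on V (defined for ν ∈ {μ, λ₁,…,λ_M}) satisfy, for all relevant pairs ν ≠ ν′: B(ν)B(ν′) = B(ν′)B(ν), A(ν)B(ν′) = f(ν,ν′)B(ν′)A(ν) − g(ν,ν′)B(ν)A(ν′), and D(ν)B(ν′) = f(ν′,ν)B(ν′)D(ν) − g(ν′,ν)B(ν)D(ν′). Suppose Ω ∈ V satisfies A(ν)Ω = a(ν)Ω and D(ν)Ω = d(ν)Ω for scalars a(ν), d(ν). Then: A(μ)·B(λ₁)⋯B(λ_M)·Ω = a(μ)·∏_{i=1}^M f(μ,λ_i)·B(λ₁)⋯B(λ_M)Ω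 + Σ_{n=1}^M a(λ_n)·g(λ_n,μ)·∏_{j≠n} f(λ_n,λ_j)·B(μ)·∏_{j≠n}B(λ_j)·Ω, and D(μ)·B(λ₁)⋯B(λ_M)·Ω = d(μ)·∏_{i=1}^M f(λ_i,μ)·B(λ₁)⋯B(λ_M)Ω + Σ_{n=1}^M d(λ_n)·g(μ,λ_n)·∏_{j≠n} f(λ_j,λ_n)·B(μ)·∏_{j≠n}B(λ_j)·Ω. -/
/-- The XXX Bethe-ansatz function `f(μ,λ) = 1 + i/(μ−λ)`. -/
noncomputable def betheF (mu lam : ℂ) : ℂ := 1 + Complex.I / (mu - lam)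

/-- The XXX Bethe-ansatz function `g(μ,λ) = i/(μ−λ)`. -/
noncomputable def betheG (mu lam : ℂ) : ℂ := Complex.I / (mu - lam)

theorem prod_univ_erase_zero {n : ℕ} (F : Fin (n + 1) → ℂ) :
    ∏ j ∈ Finset.univ.erase 0, F j = ∏ j : Fin n, F j.succ := by
  have h := Fin.prod_univ_succ fun j : Fin (n + 1) => if j ≠ 0 then F j else 1
  rw [← Finset.prod_filter, Finset.filter_ne'] at h
  simpa using h

theorem prod_univ_erase_succ {n : ℕ} (F : Fin (n + 1) → ℂ) (k : Fin n) :
    ∏ j ∈ Finset.univ.erase k.succ, F j = F 0 * ∏ j ∈ Finset.univ.erase k, F j.succ := by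
  have h := Fin.prod_univ_succ fun j : Fin (n + 1) => if j ≠ k.succ then F j else 1
  rw [← Finset.prod_filter, Finset.filter_ne'] at h
  rw [h, ← Finset.filter_ne', Finset.prod_filter]
  simp [(Fin.succ_ne_zero k).symm]

theorem filter_finRange_ne_zero (n : ℕ) :
    (List.finRange (n + 1)).filter (fun j => j ≠ 0) = (List.finRange n).map Fin.succ := by
  simp [List.finRange_succ, List.filter_map, Function.comp_def]

theorem filter_finRange_ne_succ {n : ℕ} (k : Fin n) :
    (List.finRange (n + 1)).filter (fun j => j ≠ k.succ) =
      0 :: ((List.finRange n).filter (fun j => j ≠ k)).map Fin.succ := by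
  simp [List.finRange_succ, List.filter_map, Function.comp_def, (Fin.succ_ne_zero k).symm]

/-- The expansion of `T(μ) B(λ₁)⋯B(λ_M) Ω` for an exchange relation with arbitrary coefficient
functions `f` and `g`, where `g` is antisymmetric and `f`, `g` satisfy a three-term identity. -/
theorem exchange_expansion {V : Type*} [AddCommGroup V] [Module ℂ V]
    (S : Set ℂ) (f g : ℂ → ℂ → ℂ) (T B : ℂ → Module.End ℂ V) (t : ℂ → ℂ) (Ω : V)
    (hg : ∀ x y, g x y = -g y x)
    (hfg : ∀ x y z, x ≠ y → y ≠ z → x ≠ z → f x y * g z x - g x y * g z y = g z x * f z y)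
    (hBB : ∀ ν ∈ S, ∀ ν' ∈ S, ν ≠ ν' → B ν * B ν' = B ν' * B ν)
    (hTB : ∀ ν ∈ S, ∀ ν' ∈ S, ν ≠ ν' →
      T ν * B ν' = f ν ν' • (B ν' * T ν) - g ν ν' • (B ν * T ν'))
    (hT : ∀ ν ∈ S, T ν Ω = t ν • Ω)
    (M : ℕ) (mu : ℂ) (lam : Fin M → ℂ) (hmu : mu ∈ S) (hlam : ∀ n, lam n ∈ S)
    (hdist : Function.Injective lam) (hne : ∀ n, lam n ≠ mu) :
    (T mu) ((List.ofFn fun n => B (lam n)).prod Ω) =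
      (t mu * ∏ i : Fin M, f mu (lam i)) • ((List.ofFn fun n => B (lam n)).prod Ω) +
      ∑ n : Fin M,
        (t (lam n) * g (lam n) mu * ∏ j ∈ Finset.univ.erase n, f (lam n) (lam j)) •
          ((B mu) ((((List.finRange M).filter (fun j => j ≠ n)).map
              (fun j => B (lam j))).prod Ω)) := by
  induction M generalizing mu with
  | zero => simp [hT mu hmu]
  | succ M ih =>
    have hdist' : Function.Injective fun n : Fin M => lam n.succ :=
      hdist.comp (Fin.succ_injective M)
    have h0 : ∀ n : Fin M, lam n.succ ≠ lam 0 := fun n h => Fin.succ_ne_zero n (hdist h)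
    have ih_mu := ih mu (fun n => lam n.succ) hmu (fun n => hlam _) hdist' (fun n => hne _)
    have ih_zero := ih (lam 0) (fun n => lam n.succ) (hlam 0) (fun n => hlam _) hdist' h0
    have hexch := fun X : V => LinearMap.congr_fun (hTB mu hmu (lam 0) (hlam 0) (hne 0).symm) X
    have hcomm := fun X : V => LinearMap.congr_fun (hBB (lam 0) (hlam 0) mu hmu (hne 0)) X
    simp only [Module.End.mul_apply, LinearMap.sub_apply, LinearMap.smul_apply] at hexch hcomm
    rw [Fin.sum_univ_succ, Fin.prod_univ_succ]
    simp only [filter_finRange_ne_zero, filter_finRange_ne_succ, prod_univ_erase_zero,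
      prod_univ_erase_succ, List.ofFn_succ, List.prod_cons, List.map_cons, List.map_map,
      Module.End.mul_apply, Function.comp_def]
    rw [hexch, ih_mu, ih_zero]
    simp only [map_add, map_sum, map_smul, hcomm, smul_add, Finset.smul_sum, smul_smul]
    rw [← List.ofFn_eq_map, hg (lam 0) mu]
    have hsum : ∀ n : Fin M, ∀ X : V,
        (t (lam n.succ) * g (lam n.succ) mu * (f (lam n.succ) (lam 0) *
          ∏ j ∈ Finset.univ.erase n, f (lam n.succ) (lam j.succ))) • X =
        (f mu (lam 0) * (t (lam n.succ) * g (lam n.succ) mu *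
          ∏ j ∈ Finset.univ.erase n, f (lam n.succ) (lam j.succ))) • X -
        (g mu (lam 0) * (t (lam n.succ) * g (lam n.succ) (lam 0) *
          ∏ j ∈ Finset.univ.erase n, f (lam n.succ) (lam j.succ))) • X := by
      intro n X
      rw [← sub_smul]
      congr 1
      linear_combination (-(t (lam n.succ) *
        ∏ j ∈ Finset.univ.erase n, f (lam n.succ) (lam j.succ))) *
        hfg mu (lam 0) (lam n.succ) (hne 0).symm (h0 n).symm (hne _).symm
    simp only [hsum, Finset.sum_sub_distrib]
    module

theorem betheG_antisymm (x y : ℂ) : betheG x y = -betheG y x := by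
  rw [betheG, betheG, ← neg_sub y x, div_neg]

theorem betheF_mul_betheG_sub (x y z : ℂ) (hxy : x ≠ y) (hyz : y ≠ z) (hxz : x ≠ z) :
    betheF x y * betheG z x - betheG x y * betheG z y = betheG z x * betheF z y := by
  have h1 := sub_ne_zero.2 hxy
  have h2 := sub_ne_zero.2 hyz.symm
  have h3 := sub_ne_zero.2 hxz.symm
  unfold betheF betheG
  field_simp
  ring

theorem betheF_mul_betheG_sub_swap (x y z : ℂ) (hxy : x ≠ y) (hyz : y ≠ z) (hxz : x ≠ z) :
    betheF y x * betheG x z - betheG y x * betheG y z = betheG x z * betheF y z := by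
  have h1 := sub_ne_zero.2 hxy.symm
  have h2 := sub_ne_zero.2 hyz
  have h3 := sub_ne_zero.2 hxz
  unfold betheF betheG
  field_simp
  ring

/-- **Algebraic Bethe ansatz expansion formulas.** Given operators `A(ν), B(ν), D(ν)` on a
complex vector space satisfying the XXX exchange relations on the set
`{μ, λ₁, …, λ_M}` of pairwise-distinct spectral parameters, and a vacuum `Ω` with
`A(ν)Ω = a(ν)Ω`, `D(ν)Ω = d(ν)Ω`, the actions of `A(μ)` and `D(μ)` on the Bethe vector
`B(λ₁)⋯B(λ_M)Ω` expand into a "wanted" term and `M` "unwanted" terms. -/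
theorem algebraic_bethe_ansatz_expansion
    (V : Type*) [AddCommGroup V] [Module ℂ V]
    (M : ℕ) (mu : ℂ) (lam : Fin M → ℂ)
    (hdist : Function.Injective lam) (hne : ∀ n, lam n ≠ mu)
    (A B D : ℂ → Module.End ℂ V) (a d : ℂ → ℂ) (Ω : V)
    (hBB : ∀ ν ∈ insert mu (Set.range lam), ∀ ν' ∈ insert mu (Set.range lam), ν ≠ ν' →
      B ν * B ν' = B ν' * B ν)
    (hAB : ∀ ν ∈ insert mu (Set.range lam), ∀ ν' ∈ insert mu (Set.range lam), ν ≠ ν' →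
      A ν * B ν' = betheF ν ν' • (B ν' * A ν) - betheG ν ν' • (B ν * A ν'))
    (hDB : ∀ ν ∈ insert mu (Set.range lam), ∀ ν' ∈ insert mu (Set.range lam), ν ≠ ν' →
      D ν * B ν' = betheF ν' ν • (B ν' * D ν) - betheG ν' ν • (B ν * D ν'))
    (hA : ∀ ν ∈ insert mu (Set.range lam), A ν Ω = a ν • Ω)
    (hD : ∀ ν ∈ insert mu (Set.range lam), D ν Ω = d ν • Ω) :
    (A mu) ((List.ofFn fun n => B (lam n)).prod Ω) =
      (a mu * ∏ i : Fin M, betheF mu (lam i)) • ((List.ofFn fun n => B (lam n)).prod Ω) +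
      ∑ n : Fin M,
        (a (lam n) * betheG (lam n) mu *
            ∏ j ∈ Finset.univ.erase n, betheF (lam n) (lam j)) •
          ((B mu) ((((List.finRange M).filter (fun j => j ≠ n)).map
              (fun j => B (lam j))).prod Ω)) ∧
    (D mu) ((List.ofFn fun n => B (lam n)).prod Ω) =
      (d mu * ∏ i : Fin M, betheF (lam i) mu) • ((List.ofFn fun n => B (lam n)).prod Ω) +
      ∑ n : Fin M,
        (d (lam n) * betheG mu (lam n) *
            ∏ j ∈ Finset.univ.erase n, betheF (lam j) (lam n)) •
          ((B mu) ((((List.finRange M).filter (fun j => j ≠ n)).map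
              (fun j => B (lam j))).prod Ω)) := by
  have hmu : mu ∈ insert mu (Set.range lam) := Set.mem_insert _ _
  have hlam : ∀ n, lam n ∈ insert mu (Set.range lam) := fun n => Or.inr ⟨n, rfl⟩
  exact ⟨exchange_expansion _ betheF betheG A B a Ω betheG_antisymm betheF_mul_betheG_sub
      hBB hAB hA M mu lam hmu hlam hdist hne,
    exchange_expansion _ (fun x y => betheF y x) (fun x y => betheG y x) D B d Ω
      (fun x y => betheG_antisymm y x) betheF_mul_betheG_sub_swap
      hBB hDB hD M mu lam hmu hlam hdist hne⟩
end

section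
/- Square of the CZX matrix product operator: Define A^{ij} ∈ M₂(ℂ) for i,j ∈ {0,1} by A^{01} = [[1,1],[0,0]], A^{10} = [[0,0],[1,−1]], A^{00} = A^{11} = 0, and let Ô_N = Σ Tr(A^{i₁j₁}⋯A^{i_Nj_N}) |i₁…i_N⟩⟨j₁…j_N| be the associated matrix product operator on (ℂ²)^{⊗N}. Then for every N ≥ 1, Ô_N² = (−1)^N · I, where I is the identity operator on (ℂ²)^{⊗N}. -/
/-- The CZX MPO tensor: `A^{01} = [[1,1],[0,0]]`, `A^{10} = [[0,0],[1,−1]]`,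
`A^{00} = A^{11} = 0`. -/
noncomputable def czxA (i j : Fin 2) : Matrix (Fin 2) (Fin 2) ℂ :=
  if i = 0 ∧ j = 1 then !![1, 1; 0, 0]
  else if i = 1 ∧ j = 0 then !![0, 0; 1, -1]
  else 0

/-- The CZX matrix product operator with trace closure on `(ℂ²)^{⊗N}`. -/
noncomputable def czxMPO (N : ℕ) : Matrix (Fin N → Fin 2) (Fin N → Fin 2) ℂ :=
  fun I J => Matrix.trace (List.ofFn fun n => czxA (I n) (J n)).prod

/-- An entry of the CZX operator vanishes unless the two spin configurations are opposite. -/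
theorem czxMPO_apply_eq_zero {N : ℕ} {I J : Fin N → Fin 2} (h : J ≠ 1 - I) :
    czxMPO N I J = 0 := by
  obtain ⟨n, hn⟩ := Function.ne_iff.mp h
  have hA : czxA (I n) (J n) = 0 := by
    rw [Pi.sub_apply, Pi.one_apply] at hn
    generalize I n = a at *
    generalize J n = b at *
    fin_cases a <;> fin_cases b <;> simp_all [czxA]
  rw [czxMPO, List.prod_eq_zero, Matrix.trace_zero]
  exact (List.mem_ofFn' _ _).mpr ⟨n, hA⟩

/-- The matrix product of the tensors between a configuration and its opposite has a single
nonzero row, indexed by the first spin. -/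
theorem czxA_prod_apply_eq_zero {n : ℕ} (I J : Fin (n + 1) → Fin 2) {i : Fin 2} (hi : i ≠ I 0)
    (k : Fin 2) : (List.ofFn fun m => czxA (I m) (J m)).prod i k = 0 := by
  have hA (j : Fin 2) : czxA (I 0) (J 0) i j = 0 := by
    generalize I 0 = a at *
    generalize J 0 = b at *
    fin_cases a <;> fin_cases b <;> fin_cases i <;> fin_cases j <;> simp_all [czxA]
  simp [List.ofFn_succ, Matrix.mul_apply, hA]

/-- The nonzero rows of the matrix products of a configuration and of its opposite have
entrywise product a sign. -/
theorem czxA_prod_mul_prod {n : ℕ} (I : Fin (n + 1) → Fin 2) (k : Fin 2) :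
    (List.ofFn fun m => czxA (I m) (1 - I m)).prod (I 0) k *
      (List.ofFn fun m => czxA (1 - I m) (I m)).prod (1 - I 0) (1 - k) =
      (-1) ^ (n + 1 + (I 0 : ℕ) + (k : ℕ)) := by
  induction n with
  | zero =>
    simp only [List.ofFn_succ, List.ofFn_zero, List.prod_cons, List.prod_nil, mul_one]
    generalize I 0 = a
    fin_cases a <;> fin_cases k <;> norm_num [czxA]
  | succ n ih =>
    have hX (i : Fin 2) (hi : i ≠ I 1) :=
      czxA_prod_apply_eq_zero (fun m => I m.succ) (fun m => 1 - I m.succ) hi k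
    have hY (i : Fin 2) (hi : i ≠ 1 - I 1) :=
      czxA_prod_apply_eq_zero (fun m => 1 - I m.succ) (fun m => I m.succ) hi (1 - k)
    have hXY := ih fun m => I m.succ
    rw [List.ofFn_succ (f := fun m => czxA (I m) (1 - I m)),
      List.ofFn_succ (f := fun m => czxA (1 - I m) (I m)), List.prod_cons, List.prod_cons, Matrix.mul_apply,
      Matrix.mul_apply, Finset.sum_eq_single (I 1) (fun i _ hi => by rw [hX i hi, mul_zero])
      (by simp), Finset.sum_eq_single (1 - I 1) (fun i _ hi => by rw [hY i hi, mul_zero])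
      (by simp), mul_mul_mul_comm]
    simp only [Fin.succ_zero_eq_one] at hXY
    rw [hXY]
    generalize I 0 = a
    generalize I 1 = b
    fin_cases a <;> fin_cases b <;> simp [czxA] <;> ring

/-- Opposite matrix elements of the CZX operator multiply to `(-1) ^ N`. -/
theorem czxMPO_mul_czxMPO_opposite {N : ℕ} (hN : 1 ≤ N) (I : Fin N → Fin 2) :
    czxMPO N I (1 - I) * czxMPO N (1 - I) I = (-1) ^ N := by
  obtain ⟨n, rfl⟩ := Nat.exists_eq_add_of_le' hN
  simp only [czxMPO, Matrix.trace, Matrix.diag_apply, Pi.sub_apply, Pi.one_apply]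
  rw [Finset.sum_eq_single (I 0)
      (fun i _ hi => czxA_prod_apply_eq_zero I (fun m => 1 - I m) hi i) (by simp),
    Finset.sum_eq_single (1 - I 0)
      (fun i _ hi => czxA_prod_apply_eq_zero (fun m => 1 - I m) I hi i) (by simp),
    czxA_prod_mul_prod, add_assoc, pow_add, Even.neg_one_pow ⟨_, rfl⟩, mul_one]

/-- **Square of the CZX matrix product operator**: for every `N ≥ 1`,
`Ô_N² = (−1)^N · I` on `(ℂ²)^{⊗N}`. -/
theorem czxMPO_sq (N : ℕ) (hN : 1 ≤ N) :
    czxMPO N * czxMPO N =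
      ((-1 : ℂ) ^ N) • (1 : Matrix (Fin N → Fin 2) (Fin N → Fin 2) ℂ) := by
  ext I K
  rw [Matrix.mul_apply, Finset.sum_eq_single (1 - I)
    (fun J _ hJ => by rw [czxMPO_apply_eq_zero hJ, zero_mul]) (by simp)]
  by_cases h : I = K
  · subst h
    simp [czxMPO_mul_czxMPO_opposite hN]
  · rw [czxMPO_apply_eq_zero (I := 1 - I) (by rw [sub_sub_cancel]; exact Ne.symm h)]
    simp [h]
end

section
/- Spectrum of the dimer transfer-matrix mode operator: For s ∈ ℝ, let M(s) ∈ M₄(ℂ) be the Hermitian matrix [[1,0,0,−2is],[0,1,0,0],[0,0,1,0],[2is,0,0,1+4s²]]. Then the eigenvalues of M(s) are 1 (with multiplicity two), (√(1+s²)+s)², and (√(1+s²)−s)². In particular, for s > 0 the largest eigenvalue of M(s) is (s+√(1+s²))². -/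
open Polynomial

/-- The dimer transfer-matrix mode operator
`M(s) = [[1,0,0,−2is],[0,1,0,0],[0,0,1,0],[2is,0,0,1+4s²]]`. -/
noncomputable def dimerMode (s : ℝ) : Matrix (Fin 4) (Fin 4) ℂ :=
  !![1, 0, 0, -2 * Complex.I * (s : ℂ);
     0, 1, 0, 0;
     0, 0, 1, 0;
     2 * Complex.I * (s : ℂ), 0, 0, 1 + 4 * (s : ℂ) ^ 2]

theorem dimerMode_charpoly (s : ℝ) :
    (dimerMode s).charpoly =
      (X - C 1) ^ 2 * (X ^ 2 - C (2 + 4 * (s : ℂ) ^ 2) * X + 1) := by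
  have hI : (C Complex.I : ℂ[X]) ^ 2 = -1 := by
    rw [← C_pow, Complex.I_sq, C_neg, C_1]
  have h2 : (C 2 : ℂ[X]) = 2 := C_ofNat 2
  have h4 : (C 4 : ℂ[X]) = 4 := C_ofNat 4
  simp [Matrix.charpoly, Matrix.charmatrix, dimerMode, Matrix.det_succ_row_zero,
    Fin.sum_univ_succ, Fin.succAbove, h2, h4]
  linear_combination (4 * C (s : ℂ) ^ 2 * (X - 1) ^ 2) * hI

/-- **Spectrum of the dimer transfer-matrix mode operator.** The eigenvalues of `M(s)`
are `1` (with multiplicity two), `(√(1+s²)+s)²` and `(√(1+s²)−s)²` — stated as the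
factorization of the characteristic polynomial — and for `s > 0` the largest eigenvalue
of `M(s)` is `(s+√(1+s²))²`. -/
theorem dimerMode_spectrum (s : ℝ) :
    (dimerMode s).charpoly =
      (X - C 1) ^ 2 * (X - C (((Real.sqrt (1 + s ^ 2) + s) ^ 2 : ℝ) : ℂ)) *
        (X - C (((Real.sqrt (1 + s ^ 2) - s) ^ 2 : ℝ) : ℂ)) ∧
    (0 < s →
      ((((s + Real.sqrt (1 + s ^ 2)) ^ 2 : ℝ) : ℂ) ∈ spectrum ℂ (dimerMode s) ∧
        ∀ μ ∈ spectrum ℂ (dimerMode s), ‖μ‖ ≤ (s + Real.sqrt (1 + s ^ 2)) ^ 2)) := by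
  have hsq : Real.sqrt (1 + s ^ 2) ^ 2 = 1 + s ^ 2 := Real.sq_sqrt (by positivity)
  have hr : 0 ≤ Real.sqrt (1 + s ^ 2) := Real.sqrt_nonneg _
  set r := Real.sqrt (1 + s ^ 2)
  have hfac : (dimerMode s).charpoly =
      (X - C 1) ^ 2 * (X - C (((r + s) ^ 2 : ℝ) : ℂ)) * (X - C (((r - s) ^ 2 : ℝ) : ℂ)) := by
    have hsum : (2 + 4 * (s : ℂ) ^ 2) = (((r + s) ^ 2 : ℝ) : ℂ) + (((r - s) ^ 2 : ℝ) : ℂ) := by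
      norm_cast
      linear_combination -2 * hsq
    have hprod : (((r + s) ^ 2 : ℝ) : ℂ) * (((r - s) ^ 2 : ℝ) : ℂ) = 1 := by
      norm_cast
      linear_combination (r ^ 2 - s ^ 2 + 1) * hsq
    have hprodC := congrArg (C : ℂ → ℂ[X]) hprod
    rw [C_mul, C_1] at hprodC
    rw [dimerMode_charpoly, hsum, C_add]
    linear_combination -(X - C 1) ^ 2 * hprodC
  refine ⟨hfac, fun hs => ⟨?_, fun μ hμ => ?_⟩⟩
  · rw [Matrix.mem_spectrum_iff_isRoot_charpoly, hfac, add_comm s r]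
    simp
  · rw [Matrix.mem_spectrum_iff_isRoot_charpoly, hfac] at hμ
    simp only [IsRoot.def, eval_mul, eval_pow, eval_sub, eval_X, eval_C, mul_eq_zero,
      sub_eq_zero, pow_eq_zero_iff two_ne_zero] at hμ
    rcases hμ with (rfl | rfl) | rfl
    · rw [norm_one]
      nlinarith
    · rw [Complex.norm_real, Real.norm_of_nonneg (sq_nonneg _), add_comm]
    · rw [Complex.norm_real, Real.norm_of_nonneg (sq_nonneg _)]
      nlinarith
end

section
/- The fixed-point equation for C follows from the fixed-point equation for A_C: Let T^{i,j}_{k,l} ∈ ℂ for i,j ∈ {0,…,d−1} and k,l ∈ {0,…,D′−1}; let A_L^i ∈ M_D(ℂ) satisfy the left-isometry condition Σ_i (A_L^i)† A_L^i = I_D; let F_L^k, F_R^l ∈ M_D(ℂ) and C ∈ M_D(ℂ), and let λ ∈ ℂ, λ ≠ 0. Assume (i) Σ_{i,j,k} T^{i,j}_{k,l} (A_L^i)† F_L^k A_L^j = λ F_L^l for every l, and (ii) the tensors A_C^i := A_L^i C satisfy Σ_{j,k,l} T^{i,j}_{k,l} F_L^k A_C^j F_R^l = λ A_C^i for every i.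 Then Σ_k F_L^k C F_R^k = C. -/
open Matrix

/-- **The fixed-point equation for `C` follows from the fixed-point equation for `A_C`.**
Given an MPO tensor `T`, a left-orthonormal MPS tensor `A_L`, environment tensors
`F_L, F_R`, a gauge matrix `C` and `λ ≠ 0`, if `F_L` satisfies the left environment
eigenvalue equation and `A_C = A_L C` satisfies the center-site eigenvalue equation, then
`Σ_k F_L^k C F_R^k = C`. -/
theorem C_fixed_point_of_AC_fixed_point
    (d D' D : ℕ)
    (T : Fin d → Fin d → Fin D' → Fin D' → ℂ)
    (AL : Fin d → Matrix (Fin D) (Fin D) ℂ)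
    (hAL : ∑ i : Fin d, (AL i)ᴴ * AL i = 1)
    (FL FR : Fin D' → Matrix (Fin D) (Fin D) ℂ)
    (C : Matrix (Fin D) (Fin D) ℂ)
    (lam : ℂ) (hlam : lam ≠ 0)
    (hFL : ∀ l : Fin D',
      ∑ i : Fin d, ∑ j : Fin d, ∑ k : Fin D',
        T i j k l • ((AL i)ᴴ * FL k * AL j) = lam • FL l)
    (hAC : ∀ i : Fin d,
      ∑ j : Fin d, ∑ k : Fin D', ∑ l : Fin D',
        T i j k l • (FL k * (AL j * C) * FR l) = lam • (AL i * C)) :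
    ∑ k : Fin D', FL k * C * FR k = C := by
  refine smul_right_injective _ hlam ?_
  calc lam • ∑ l, FL l * C * FR l
      = ∑ l, (lam • FL l) * C * FR l := by
        simp only [Finset.smul_sum, Matrix.smul_mul]
    _ = ∑ l, ∑ i, ∑ j, ∑ k, T i j k l • ((AL i)ᴴ * (FL k * (AL j * C) * FR l)) := by
        simp only [← hFL, Finset.sum_mul, Matrix.smul_mul, Matrix.mul_assoc]
    _ = ∑ i, ∑ j, ∑ k, ∑ l, T i j k l • ((AL i)ᴴ * (FL k * (AL j * C) * FR l)) := by
        rw [Finset.sum_comm]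
        refine Finset.sum_congr rfl fun i _ => ?_
        rw [Finset.sum_comm]
        exact Finset.sum_congr rfl fun j _ => Finset.sum_comm
    _ = ∑ i, (AL i)ᴴ * (lam • (AL i * C)) := by
        simp only [← hAC, Finset.mul_sum, Matrix.mul_smul]
    _ = lam • ((∑ i, (AL i)ᴴ * AL i) * C) := by
        simp only [Finset.sum_mul, Finset.smul_sum, Matrix.mul_smul, Matrix.mul_assoc]
    _ = lam • C := by rw [hAL, Matrix.one_mul]
end

section
/- Zipper lemma — a sufficient condition for an MPS to be an eigenvector of an MPO: Let T^{ij} ∈ M_{D′}(ℂ) for i,j ∈ {0,…,d−1} with boundary vectors ℓ_T, r_T ∈ ℂ^{D′}, defining the matrix product operator O_N on (ℂ^d)^{⊗N} with entries ⟨i₁…i_N|O_N|j₁…j_N⟩ = ℓ_T† T^{i₁j₁}⋯T^{i_Nj_N} r_T. Let A^i ∈ M_D(ℂ) with boundary vectors ℓ_A, r_A ∈ ℂ^D, defining the matrix product state p_N with coefficients p_N(i₁,…,i_N) = ℓ_A† A^{i₁}⋯A^{i_N} r_A. Suppose there exist λ ∈ ℂ and a (D′·D)×D matrix Z such that: (i)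 (Σ_j T^{ij} ⊗ A^j)·Z = λ·Z·A^i for every i; (ii) (ℓ_T ⊗ ℓ_A)† Z = ℓ_A†; (iii) Z r_A = r_T ⊗ r_A. Then for every N ≥ 1, O_N p_N = λ^N p_N. -/
open Matrix

/-- The open-boundary MPO on `(ℂ^d)^{⊗N}` with tensor `T` and boundary vectors `ℓ_T, r_T`:
`⟨i₁…i_N|O_N|j₁…j_N⟩ = ℓ_T† T^{i₁j₁}⋯T^{i_Nj_N} r_T`. -/
noncomputable def mpoOpen {d D' : ℕ} (T : Fin d → Fin d → Matrix (Fin D') (Fin D') ℂ)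
    (lT rT : Fin D' → ℂ) (N : ℕ) : Matrix (Fin N → Fin d) (Fin N → Fin d) ℂ :=
  Matrix.of fun I J =>
    star lT ⬝ᵥ ((List.ofFn fun n => T (I n) (J n)).prod).mulVec rT

/-- The open-boundary MPS on `(ℂ^d)^{⊗N}` with tensors `A` and boundary vectors
`ℓ_A, r_A`: `p_N(i₁,…,i_N) = ℓ_A† A^{i₁}⋯A^{i_N} r_A`. -/
noncomputable def mpsOpen {d D : ℕ} (A : Fin d → Matrix (Fin D) (Fin D) ℂ)
    (lA rA : Fin D → ℂ) (N : ℕ) : (Fin N → Fin d) → ℂ :=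
  fun I => star lA ⬝ᵥ ((List.ofFn fun n => A (I n)).prod).mulVec rA

open scoped Kronecker in
/-- Distributivity of an ordered product of sums of Kronecker products. -/
theorem sum_prod_ofFn_kronecker {R ι m n : Type*} [CommSemiring R] [Fintype ι]
    [Fintype m] [DecidableEq m] [Fintype n] [DecidableEq n] {N : ℕ}
    (S : Fin N → ι → Matrix m m R) (A : ι → Matrix n n R) :
    ∑ J : Fin N → ι,
        (List.ofFn fun k => S k (J k)).prod ⊗ₖ (List.ofFn fun k => A (J k)).prod =
      (List.ofFn fun k => ∑ j, S k j ⊗ₖ A j).prod := by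
  induction N with
  | zero => simp
  | succ N ih =>
    rw [← (Fin.consEquiv fun _ => ι).sum_comp, Fintype.sum_prod_type]
    simp only [Fin.consEquiv_apply, List.ofFn_succ, List.prod_cons, Fin.cons_zero,
      Fin.cons_succ, mul_kronecker_mul, ← Finset.mul_sum, ih fun k => S k.succ,
      ← Finset.sum_mul]

/-- If `Z` intertwines each `B i` with `lam • A i`, it intertwines their ordered products. -/
theorem prod_ofFn_mul_of_intertwines {R ι m n : Type*} [CommSemiring R]
    [Fintype m] [DecidableEq m] [Fintype n] [DecidableEq n]
    {B : ι → Matrix m m R} {A : ι → Matrix n n R} {Z : Matrix m n R} {lam : R}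
    (h : ∀ i, B i * Z = lam • (Z * A i)) {N : ℕ} (I : Fin N → ι) :
    (List.ofFn fun k => B (I k)).prod * Z =
      lam ^ N • (Z * (List.ofFn fun k => A (I k)).prod) := by
  induction N with
  | zero => simp
  | succ N ih =>
    simp only [List.ofFn_succ, List.prod_cons]
    rw [Matrix.mul_assoc, ih fun k => I k.succ, Matrix.mul_smul, ← Matrix.mul_assoc, h,
      Matrix.smul_mul, smul_smul, pow_succ, Matrix.mul_assoc]

open scoped Kronecker in
/-- Matrix elements of a Kronecker product between product vectors factorize. -/
theorem dotProduct_kronecker_mulVec {R m n : Type*} [CommSemiring R] [Fintype m] [Fintype n]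
    (u x : m → R) (v y : n → R) (M : Matrix m m R) (N : Matrix n n R) :
    (fun p : m × n => u p.1 * v p.2) ⬝ᵥ (M ⊗ₖ N) *ᵥ (fun p : m × n => x p.1 * y p.2) =
      (u ⬝ᵥ M *ᵥ x) * (v ⬝ᵥ N *ᵥ y) := by
  have hmul : (M ⊗ₖ N) *ᵥ (fun p : m × n => x p.1 * y p.2) =
      fun p => (M *ᵥ x) p.1 * (N *ᵥ y) p.2 := by
    ext p
    simp only [mulVec, dotProduct, kroneckerMap_apply, Fintype.sum_prod_type,
      Finset.sum_mul_sum, mul_mul_mul_comm]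
  rw [hmul]
  simp only [dotProduct, Fintype.sum_prod_type, Finset.sum_mul_sum, mul_mul_mul_comm]

/-- **Zipper lemma: a sufficient condition for an MPS to be an eigenvector of an MPO.**
If there are `λ ∈ ℂ` and a `(D′·D) × D` matrix `Z` with
(i) `(Σ_j T^{ij} ⊗ A^j)·Z = λ·Z·A^i` for all `i`, (ii) `(ℓ_T ⊗ ℓ_A)† Z = ℓ_A†`,
(iii) `Z r_A = r_T ⊗ r_A`, then `O_N p_N = λ^N p_N` for every `N ≥ 1`. -/
theorem zipper_lemma
    (d D' D : ℕ)
    (T : Fin d → Fin d → Matrix (Fin D') (Fin D') ℂ)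
    (lT rT : Fin D' → ℂ)
    (A : Fin d → Matrix (Fin D) (Fin D) ℂ)
    (lA rA : Fin D → ℂ)
    (lam : ℂ)
    (Z : Matrix (Fin D' × Fin D) (Fin D) ℂ)
    (hzip : ∀ i : Fin d,
      (∑ j : Fin d,
        Matrix.of (fun p q : Fin D' × Fin D => T i j p.1 q.1 * A j p.2 q.2)) * Z =
      lam • (Z * A i))
    (hleft : (star fun p : Fin D' × Fin D => lT p.1 * lA p.2) ᵥ* Z = star lA)
    (hright : Z.mulVec rA = fun p : Fin D' × Fin D => rT p.1 * rA p.2) :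
    ∀ N : ℕ, 1 ≤ N →
      (mpoOpen T lT rT N).mulVec (mpsOpen A lA rA N) =
        (lam ^ N) • mpsOpen A lA rA N := by
  intro N _
  ext I
  have hstar : (star fun p : Fin D' × Fin D => lT p.1 * lA p.2) =
      fun p => star lT p.1 * star lA p.2 := by
    ext p
    simp
  calc (mpoOpen T lT rT N *ᵥ mpsOpen A lA rA N) I
      = ∑ J : Fin N → Fin d,
          (star fun p : Fin D' × Fin D => lT p.1 * lA p.2) ⬝ᵥ
            (kroneckerMap (· * ·) (List.ofFn fun k => T (I k) (J k)).prod
              (List.ofFn fun k => A (J k)).prod) *ᵥ (Z *ᵥ rA) := by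
        simp only [hright, hstar, dotProduct_kronecker_mulVec]
        rfl
    _ = (star fun p : Fin D' × Fin D => lT p.1 * lA p.2) ⬝ᵥ
          ((List.ofFn fun k => ∑ j, kroneckerMap (· * ·) (T (I k) j) (A j)).prod * Z) *ᵥ
            rA := by
        rw [← dotProduct_sum, ← sum_mulVec, sum_prod_ofFn_kronecker (fun k => T (I k)) A,
          mulVec_mulVec]
    _ = lam ^ N * (star lA ⬝ᵥ (List.ofFn fun k => A (I k)).prod *ᵥ rA) := by
        rw [prod_ofFn_mul_of_intertwines (B := fun i => ∑ j, kroneckerMap (· * ·) (T i j) (A j))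
          hzip, smul_mulVec, dotProduct_smul, ← mulVec_mulVec, dotProduct_mulVec, hleft,
          smul_eq_mul]
    _ = (lam ^ N • mpsOpen A lA rA N) I := rfl
end

section
/- Schmidt-rank bound for MPS with band-diagonal matrices: Let N = 2m be even, let d ≥ 1, and let A^i (i ∈ {0,…,d−1}) be linear operators on the space of finitely supported complex sequences (ℕ → ℂ) that are band matrices of bandwidth one: (A^i)_{rs} = 0 whenever |r − s| > 1. Let L = e₀ (the coordinate functional at index 0) and let R be any finitely supported sequence. Then the d^m × d^m matrix P with entries P[(i₁,…,i_m), (i_{m+1},…,i_{2m})] = ⟨e₀, A^{i₁}A^{i₂}⋯A^{i_{2m}} R⟩ has rank at most m + 1. In particular the half-chain Schmidt rank of the matrix product state with these tensors and boundary vectors is at most N/2 + 1, exponentially smaller than the generic value d^{N/2}. -/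
theorem Module.End.finsupp_apply_eq_sum (X : Module.End ℂ (ℕ →₀ ℂ)) (v : ℕ →₀ ℂ) (r : ℕ) :
    X v r = v.sum fun s c => X (Finsupp.single s 1) r * c := by
  conv_lhs => rw [← Finsupp.sum_single v]
  rw [Finsupp.sum, map_sum, Finsupp.finsetSum_apply, Finsupp.sum]
  refine Finset.sum_congr rfl fun s _ => ?_
  rw [← Finsupp.smul_single_one s (v s), map_smul, Finsupp.smul_apply, smul_eq_mul, mul_comm]

/-- A product of `l.length` operators, each lowering the index by at most one, lowers the index
by at most `l.length`. -/
theorem Module.End.list_prod_single_apply_eq_zero (l : List (Module.End ℂ (ℕ →₀ ℂ)))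
    (hl : ∀ X ∈ l, ∀ r s : ℕ, r + 1 < s → X (Finsupp.single s 1) r = 0)
    (r s : ℕ) (hrs : r + l.length < s) : l.prod (Finsupp.single s 1) r = 0 := by
  induction l generalizing r with
  | nil =>
    have h : s ≠ r := by simp at hrs; omega
    simp [Finsupp.single_eq_of_ne' h]
  | cons X t ih =>
    rw [List.prod_cons, Module.End.mul_apply, finsupp_apply_eq_sum]
    refine Finset.sum_eq_zero fun u _ => ?_
    rw [List.length_cons] at hrs
    by_cases hu : r + 1 < u
    · simp [hl X (by simp) r u hu]
    · simp [ih (fun Y hY => hl Y (List.mem_cons_of_mem _ hY)) u (by omega)]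

/-- If the row `r` of an operator is supported on the first `n` indices, then the corresponding
coordinate of its values is a sum over these indices. -/
theorem Module.End.finsupp_apply_eq_sum_fin (X : Module.End ℂ (ℕ →₀ ℂ)) (v : ℕ →₀ ℂ) (r n : ℕ)
    (hX : ∀ s, n ≤ s → X (Finsupp.single s 1) r = 0) :
    X v r = ∑ s : Fin n, X (Finsupp.single (s : ℕ) 1) r * v s := by
  rw [finsupp_apply_eq_sum, ← Finset.sum_range fun s : ℕ => X (Finsupp.single s 1) r * v s,
    Finsupp.sum]
  refine Finset.sum_congr_of_eq_on_inter ?_ ?_ fun _ _ _ => rfl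
  · intro s _ hs
    simp [hX s (by simpa using hs)]
  · intro s _ hs
    simp [Finsupp.notMem_support_iff.mp hs]


/-- **Schmidt-rank bound for MPS with band-diagonal matrices.**
Let `N = 2m`, and let `A^i` be linear operators on the space `ℕ →₀ ℂ` of finitely
supported complex sequences that are band matrices of bandwidth one (their matrix entries
`(A^i)_{rs} = ⟨e_r, A^i e_s⟩` vanish whenever `|r − s| > 1`). With left boundary the
coordinate functional `e₀` and right boundary any `R ∈ ℕ →₀ ℂ`, the `d^m × d^m` matrix of
MPS coefficients `P[(i₁,…,i_m),(i_{m+1},…,i_{2m})] = ⟨e₀, A^{i₁}⋯A^{i_{2m}} R⟩` has rank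
at most `m + 1`; i.e., the half-chain Schmidt rank is at most `N/2 + 1`. -/
theorem band_mps_schmidt_rank_bound
    (m d : ℕ) (hd : 1 ≤ d)
    (A : Fin d → Module.End ℂ (ℕ →₀ ℂ))
    (hband : ∀ i : Fin d, ∀ r s : ℕ, (r + 1 < s ∨ s + 1 < r) →
      (A i (Finsupp.single s 1)) r = 0)
    (R : ℕ →₀ ℂ) :
    Matrix.rank
      (Matrix.of fun I J : Fin m → Fin d =>
        (((List.ofFn fun n => A (I n)).prod * (List.ofFn fun n => A (J n)).prod) R) 0)
      ≤ m + 1 := by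
  let B : Matrix (Fin m → Fin d) (Fin (m + 1)) ℂ := Matrix.of fun I s =>
    (List.ofFn fun n => A (I n)).prod (Finsupp.single (s : ℕ) 1) 0
  let C : Matrix (Fin (m + 1)) (Fin m → Fin d) ℂ := Matrix.of fun s J =>
    (List.ofFn fun n => A (J n)).prod R s
  have hBC : (Matrix.of fun I J : Fin m → Fin d =>
      (((List.ofFn fun n => A (I n)).prod * (List.ofFn fun n => A (J n)).prod) R) 0) = B * C := by
    ext I J
    rw [Matrix.mul_apply, Matrix.of_apply, Module.End.mul_apply]
    refine Module.End.finsupp_apply_eq_sum_fin _ _ 0 (m + 1) fun s hs =>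
      Module.End.list_prod_single_apply_eq_zero _ ?_ 0 s (by rw [List.length_ofFn]; omega)
    intro X hX r s hrs
    obtain ⟨n, rfl⟩ := (List.mem_ofFn' _ _).mp hX
    exact hband (I n) r s (Or.inl hrs)
  rw [hBC]
  exact (Matrix.rank_mul_le_left B C).trans (by simpa using B.rank_le_card_width)
end
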